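/- Set A(0)=0. For 1≤n≤13, A(n)−A(n−1)=1 if n∈{8,10} and A(n)=A(n−1) otherwise. For n≥14, let m be the unique integer with 2t_{m-1} ≤ n < 2t_m (necessarily m≥4); then A(n)−A(n−1)=1 if n lies in the set {2t_{m-1}, 2t_{m-1}+1, …, t_m+2t_{m-3}−1} ∪ {2t_m−t_{m-1}, …, (3t_m+t_{m-2}−3)/2}, and A(n)=A(n−1) otherwise. -/

import Mathlib

/-- The three-letter alphabet of the Tribonacci word. -/
inductive TLetter : Type
  | a | b | c
deriving DecidableEq

/-- The Tribonacci substitution σ(a)=ab, σ(b)=ac, σ(c)=a. -/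
def tsubst : TLetter → List TLetter
  | .a => [.a, .b]
  | .b => [.a, .c]
  | .c => [.a]

/-- `Tword m = σ^m(a)`, the m-th finite Tribonacci word. -/
def Tword : ℕ → List TLetter
  | 0 => [.a]
  | n + 1 => (Tword n).flatMap tsubst

/-- The prefix 𝕋[1,n] of the Tribonacci word of length n
(each `Tword n` is a prefix of the next and has length ≥ n). -/
def TPrefix (n : ℕ) : List TLetter := (Tword n).take n

/-- A word is a factor of the Tribonacci word 𝕋. -/
def IsFactorT (w : List TLetter) : Prop := ∃ m, w <:+: Tword m

/-- `tribAux i = t_{i-2}`: Tribonacci numbers, shifted so that the index is a natural. -/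
def tribAux : ℕ → ℕ
  | 0 => 0
  | 1 => 1
  | 2 => 1
  | n + 3 => tribAux (n + 2) + tribAux (n + 1) + tribAux n

/-- The Tribonacci numbers `t m` for `m : ℤ`: t₋₂=0, t₋₁=1, t₀=1,
`t m = t (m-1) + t (m-2) + t (m-3)` for m ≥ 1. (Junk value 0 below -2.) -/
def t (m : ℤ) : ℕ := tribAux (m + 2).toNat

/-- Kernel numbers: k₀=0, k₁=k₂=1, `k m = k (m-1) + k (m-2) + k (m-3) - 1` for m ≥ 3. -/
def kAux : ℕ → ℕ
  | 0 => 0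
  | 1 => 1
  | 2 => 1
  | n + 3 => kAux (n + 2) + kAux (n + 1) + kAux n - 1

def kker (m : ℤ) : ℕ := kAux m.toNat

/-- `A n`: the number of distinct nonempty words w with ww a factor of 𝕋[1,n]. -/
noncomputable def A (n : ℕ) : ℕ := Nat.card {w : List TLetter // w ≠ [] ∧ (w ++ w) <:+: TPrefix n}

/-- `B n`: the number of occurrences of squares in 𝕋[1,n], i.e. of pairs (w,i) with
w nonempty, i ≥ 1, ww occurring in 𝕋 at position i and i + 2|w| - 1 ≤ n. -/
noncomputable def B (n : ℕ) : ℕ :=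
  Nat.card {p : List TLetter × ℕ // p.1 ≠ [] ∧ 1 ≤ p.2 ∧
    p.2 + 2 * p.1.length - 1 ≤ n ∧ (p.1 ++ p.1) <+: (TPrefix n).drop (p.2 - 1)}

/-- `C n`: the number of distinct nonempty words w with www a factor of 𝕋[1,n]. -/
noncomputable def C (n : ℕ) : ℕ := Nat.card {w : List TLetter // w ≠ [] ∧ (w ++ w ++ w) <:+: TPrefix n}

/-- `D n`: the number of occurrences of cubes in 𝕋[1,n], i.e. of pairs (w,i) with
w nonempty, i ≥ 1, www occurring in 𝕋 at position i and i + 3|w| - 1 ≤ n. -/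
noncomputable def D (n : ℕ) : ℕ :=
  Nat.card {p : List TLetter × ℕ // p.1 ≠ [] ∧ 1 ≤ p.2 ∧
    p.2 + 3 * p.1.length - 1 ≤ n ∧ (p.1 ++ p.1 ++ p.1) <+: (TPrefix n).drop (p.2 - 1)}

namespace Tribonacci

open Function

/-! ### The infinite word -/

theorem Tword_prefix_succ (n : ℕ) : Tword n <+: Tword (n + 1) := by
  induction n with
  | zero => exact ⟨[.b], rfl⟩
  | succ n ih => exact ih.flatMap tsubst

theorem Tword_prefix {m n : ℕ} (h : m ≤ n) : Tword m <+: Tword n := by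
  induction n, h using Nat.le_induction with
  | base => exact List.prefix_rfl
  | succ n _ ih => exact ih.trans (Tword_prefix_succ n)

theorem length_le_length_flatMap_tsubst (l : List TLetter) :
    l.length ≤ (l.flatMap tsubst).length := by
  induction l with
  | nil => simp
  | cons x l ih =>
    have : 1 ≤ (tsubst x).length := by cases x <;> simp [tsubst]
    rw [List.flatMap_cons, List.length_append, List.length_cons]
    omega

theorem lt_length_Tword (n : ℕ) : n < (Tword n).length := by
  induction n with
  | zero => simp [Tword]
  | succ n ih =>
    obtain ⟨r, hr⟩ := Tword_prefix (Nat.zero_le n)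
    have h := length_le_length_flatMap_tsubst r
    rw [← hr] at ih
    simp only [Tword, List.length_append, List.length_cons, List.length_nil] at ih
    simp only [Tword, ← hr, List.flatMap_append, List.length_append, List.flatMap_cons, tsubst,
      List.flatMap_nil, List.length_cons, List.length_nil]
    omega

/-- The letter of the Tribonacci word at (zero-based) position `i`. -/
def letter (i : ℕ) : TLetter := (Tword i)[i]'(lt_length_Tword i)

theorem getElem_Tword {n i : ℕ} (h : i < (Tword n).length) : (Tword n)[i] = letter i := by
  rcases le_total i n with hin | hin
  · exact ((Tword_prefix hin).getElem (lt_length_Tword i)).symm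
  · exact (Tword_prefix hin).getElem h

theorem eq_map_of_prefix_Tword {l : List TLetter} {n : ℕ} (h : l <+: Tword n) :
    l = (List.range l.length).map letter := by
  apply List.ext_getElem
  · simp
  · intro i hi _
    rw [h.getElem hi, getElem_Tword]
    simp

theorem TPrefix_eq_map (n : ℕ) : TPrefix n = (List.range n).map letter := by
  have h := eq_map_of_prefix_Tword (List.take_prefix n (Tword n))
  have hn := lt_length_Tword n
  rwa [List.length_take, min_eq_left hn.le] at h

/-- The length of the image under the substitution of the prefix of length `i`. -/
def pos : ℕ → ℕ
  | 0 => 0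
  | i + 1 => pos i + (tsubst (letter i)).length

theorem flatMap_map_letter (i : ℕ) :
    ((List.range i).map letter).flatMap tsubst = (List.range (pos i)).map letter := by
  have hlen : (((List.range i).map letter).flatMap tsubst).length = pos i := by
    induction i with
    | zero => rfl
    | succ i ih =>
      rw [List.range_succ, List.map_append, List.flatMap_append, List.length_append, ih]
      simp [pos]
  have hp : (List.range i).map letter <+: Tword i := by
    rw [← TPrefix_eq_map]
    exact List.take_prefix _ _
  have h := eq_map_of_prefix_Tword (n := i + 1) (hp.flatMap tsubst)
  rwa [hlen] at h

theorem map_letter_pos_succ (i : ℕ) :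
    (List.range (pos (i + 1))).map letter =
      (List.range (pos i)).map letter ++ tsubst (letter i) := by
  rw [← flatMap_map_letter, ← flatMap_map_letter, List.range_succ]
  simp

theorem letter_pos_add {i j : ℕ} (h : j < (tsubst (letter i)).length) :
    letter (pos i + j) = (tsubst (letter i))[j] := by
  have h1 := congrArg (fun l => l[pos i + j]?) (map_letter_pos_succ i)
  have h2 : pos i + j < pos (i + 1) := by
    simp only [pos]
    omega
  simpa [List.getElem?_append, h2, h] using h1

@[simp] theorem letter_pos (i : ℕ) : letter (pos i) = .a := by
  have h : 0 < (tsubst (letter i)).length := by cases letter i <;> simp [tsubst]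
  have h1 := letter_pos_add h
  rw [Nat.add_zero] at h1
  rw [h1]
  generalize letter i = x at h
  cases x <;> rfl

/-- The letter following the first letter of the image of a given letter. -/
def next : TLetter → TLetter
  | .a => .b
  | .b => .c
  | .c => .a

theorem next_injective : Injective next := by
  intro x y
  cases x <;> cases y <;> simp [next]

theorem letter_pos_add_one (i : ℕ) : letter (pos i + 1) = next (letter i) := by
  have h := @letter_pos_add i 1
  have h2 := letter_pos (i + 1)
  rw [pos] at h2
  generalize letter i = x at h h2 ⊢
  cases x
  · simpa [tsubst, next] using h
  · simpa [tsubst, next] using h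
  · simpa [tsubst, next] using h2

theorem pos_succ_of_ne {i : ℕ} (h : letter i ≠ .c) : pos (i + 1) = pos i + 2 := by
  rw [pos]
  generalize letter i = x at h
  cases x <;> simp_all [tsubst]

theorem pos_succ_of_eq {i : ℕ} (h : letter i = .c) : pos (i + 1) = pos i + 1 := by
  rw [pos, h]
  rfl

theorem pos_strictMono : StrictMono pos := by
  apply strictMono_nat_of_lt_succ
  intro i
  by_cases h : letter i = .c
  · rw [pos_succ_of_eq h]
    omega
  · rw [pos_succ_of_ne h]
    omega

theorem exists_pos (n : ℕ) :
    ∃ i, n = pos i ∨ (n = pos i + 1 ∧ letter i ≠ .c) := by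
  induction n with
  | zero => exact ⟨0, Or.inl rfl⟩
  | succ n ih =>
    obtain ⟨i, rfl | ⟨rfl, hi⟩⟩ := ih
    · by_cases h : letter i = .c
      · exact ⟨i + 1, Or.inl (pos_succ_of_eq h).symm⟩
      · exact ⟨i, Or.inr ⟨rfl, h⟩⟩
    · exact ⟨i + 1, Or.inl (pos_succ_of_ne hi).symm⟩

theorem letter_eq_a_iff {n : ℕ} : letter n = .a ↔ ∃ i, n = pos i := by
  constructor
  · intro h
    obtain ⟨i, rfl | ⟨rfl, hi⟩⟩ := exists_pos n
    · exact ⟨i, rfl⟩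
    · rw [letter_pos_add_one] at h
      generalize letter i = x at h hi
      cases x <;> simp_all [next]
  · rintro ⟨i, rfl⟩
    exact letter_pos i

theorem letter_succ_of_ne_a {n : ℕ} (h : letter n ≠ .a) : letter (n + 1) = .a := by
  obtain ⟨i, rfl | ⟨rfl, hi⟩⟩ := exists_pos n
  · exact absurd (letter_pos i) h
  · rw [show pos i + 1 + 1 = pos (i + 1) from (pos_succ_of_ne hi).symm]
    exact letter_pos _

theorem letter_zero : letter 0 = .a := letter_pos 0

theorem letter_one : letter 1 = .b := rfl

theorem letter_two : letter 2 = .a := rfl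

theorem letter_three : letter 3 = .c := rfl

/-! ### Iterating the substitution -/

/-- The length of the image of a letter under the `k`-th power of the substitution. -/
def len (k : ℕ) : TLetter → ℕ
  | .a => tribAux (k + 2)
  | .b => tribAux (k + 1) + tribAux k
  | .c => tribAux (k + 1)

theorem iterate_pos_zero (k : ℕ) : pos^[k] 0 = 0 := iterate_fixed rfl k

theorem iterate_pos_succ (k i : ℕ) : pos^[k] (i + 1) = pos^[k] i + len k (letter i) := by
  induction k generalizing i with
  | zero =>
    generalize letter i = x
    cases x <;> rfl
  | succ k ih =>
    rw [iterate_succ_apply, iterate_succ_apply]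
    by_cases h : letter i = .c
    · rw [pos_succ_of_eq h, ih, letter_pos, h]
      rfl
    · rw [pos_succ_of_ne h, ih, ih, letter_pos, letter_pos_add_one]
      generalize letter i = x at h
      have e : tribAux (k + 3) = tribAux (k + 2) + tribAux (k + 1) + tribAux k := rfl
      cases x
      · simp only [len, next, Nat.add_assoc, Nat.reduceAdd]
        omega
      · simp only [len, next, Nat.add_assoc, Nat.reduceAdd]
      · contradiction

theorem iterate_pos_one (k : ℕ) : pos^[k] 1 = tribAux (k + 2) := by
  have h := iterate_pos_succ k 0
  rwa [iterate_pos_zero, letter_zero, Nat.zero_add, Nat.zero_add] at h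

theorem iterate_pos_three (k : ℕ) :
    pos^[k] 3 = 2 * tribAux (k + 2) + tribAux (k + 1) + tribAux k := by
  rw [iterate_pos_succ, iterate_pos_succ, iterate_pos_one, letter_one, letter_two]
  simp only [len]
  omega

theorem letter_iterate_add_of_lt_len (k : ℕ) {i i' j : ℕ} (h : letter i = letter i')
    (hj : j < len k (letter i)) : letter (pos^[k] i + j) = letter (pos^[k] i' + j) := by
  induction k generalizing i i' j with
  | zero =>
    have : j = 0 := by
      generalize letter i = x at hj
      cases x <;> simp [len, tribAux] at hj <;> omega
    simpa [this] using h
  | succ k ih =>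
    rw [iterate_succ_apply, iterate_succ_apply]
    by_cases hj2 : j < tribAux (k + 2)
    · exact ih (by simp) (by simpa [len] using hj2)
    · obtain ⟨j, rfl⟩ := Nat.exists_eq_add_of_le (not_lt.1 hj2)
      have e (l : ℕ) : pos^[k] (pos l) + (tribAux (k + 2) + j) = pos^[k] (pos l + 1) + j := by
        rw [iterate_pos_succ, letter_pos]
        simp only [len]
        omega
      rw [e, e]
      apply ih
      · rw [letter_pos_add_one, letter_pos_add_one, h]
      · rw [letter_pos_add_one]
        generalize letter i = x at hj
        cases x <;> simp [len, next, tribAux] at hj ⊢ <;> omega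

/-- The lengths of the longest words separating two occurrences of distinct letters
after `k` applications of the substitution. -/
def bisp : ℕ → ℕ
  | 0 => 0
  | k + 1 => pos (bisp k) + 1

theorem pos_add_of_letter_eq {s b : ℕ} (h : ∀ j < b, letter (s + j) = letter j) :
    ∀ j ≤ b, pos (s + j) = pos s + pos j := by
  intro j
  induction j with
  | zero => simp [pos]
  | succ j ih =>
    intro hj
    rw [← add_assoc, pos, pos, ih (by omega), h j (by omega)]
    omega

theorem letter_iterate_add (k i : ℕ) {j : ℕ} (hj : j < bisp k) :
    letter (pos^[k] i + j) = letter j := by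
  induction k generalizing j with
  | zero => simp [bisp] at hj
  | succ k ih =>
    have hp := pos_add_of_letter_eq (s := pos^[k] i) (fun j hj => ih hj)
    rw [bisp] at hj
    rw [iterate_succ_apply']
    obtain ⟨l, rfl | ⟨rfl, hl⟩⟩ := exists_pos j
    · have hl := pos_strictMono.le_iff_le.1 (Nat.lt_succ_iff.1 hj)
      rw [← hp l hl, letter_pos, letter_pos]
    · have hl := pos_strictMono.lt_iff_lt.1 (Nat.lt_of_succ_lt_succ hj)
      rw [← add_assoc, ← hp l hl.le, letter_pos_add_one, letter_pos_add_one, ih hl]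

theorem pos_iterate_add (k i : ℕ) {j : ℕ} (hj : j ≤ bisp k) :
    pos (pos^[k] i + j) = pos^[k + 1] i + pos j := by
  rw [iterate_succ_apply']
  exact pos_add_of_letter_eq (fun j hj => letter_iterate_add k i hj) j hj

theorem letter_iterate_add_congr (k : ℕ) {i i' j : ℕ} (h : letter i = letter i')
    (hj : j < len k (letter i) + bisp k) :
    letter (pos^[k] i + j) = letter (pos^[k] i' + j) := by
  by_cases hj2 : j < len k (letter i)
  · exact letter_iterate_add_of_lt_len k h hj2
  · obtain ⟨j, rfl⟩ := Nat.exists_eq_add_of_le (not_lt.1 hj2)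
    have hjb : j < bisp k := by omega
    rw [← add_assoc, ← iterate_pos_succ, h, ← add_assoc, ← iterate_pos_succ,
      letter_iterate_add k _ hjb, letter_iterate_add k _ hjb]

theorem bisp_succ (k : ℕ) : bisp (k + 1) = bisp k + tribAux (k + 2) := by
  induction k with
  | zero => rfl
  | succ k ih =>
    have h := pos_iterate_add k 1 (le_refl (bisp k))
    rw [iterate_pos_one, iterate_pos_one] at h
    have h2 : bisp (k + 1) = pos (bisp k) + 1 := rfl
    rw [bisp, ih, add_comm (bisp k), h]
    omega

theorem two_mul_bisp_add (k : ℕ) : 2 * bisp k + 3 = tribAux (k + 3) + tribAux (k + 1) := by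
  induction k with
  | zero => rfl
  | succ k ih =>
    have e1 : tribAux (k + 4) = tribAux (k + 3) + tribAux (k + 2) + tribAux (k + 1) := rfl
    simp only [bisp_succ, Nat.add_assoc, Nat.reduceAdd] at ih ⊢
    omega

theorem bisp_mono : Monotone bisp := by
  apply monotone_nat_of_le_succ
  intro k
  rw [bisp_succ]
  omega

/-! ### Repetitions -/

/-- Every repetition of period `p` comes from an empty repetition by iterating the substitution. -/
theorem exists_level_of_shift {p s e : ℕ} (hp : 1 ≤ p) (hse : s ≤ e)
    (h : ∀ j, s ≤ j → j < e → letter j = letter (j + p)) :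
    ∃ k i q, 1 ≤ q ∧ pos^[k] i ≤ s ∧ e ≤ pos^[k] i + bisp k ∧
      pos^[k] i + p = pos^[k] (i + q) := by
  induction e using Nat.strong_induction_on generalizing s p with
  | _ e ih =>
  obtain rfl | hlt := hse.eq_or_lt
  · exact ⟨0, s, p, hp, le_rfl, le_rfl, rfl⟩
  obtain ⟨s', hs', hs'a, h'⟩ : ∃ s' ≤ s, letter s' = .a ∧
      ∀ j, s' ≤ j → j < e → letter j = letter (j + p) := by
    by_cases hsa : letter s = .a
    · exact ⟨s, le_rfl, hsa, h⟩
    · obtain _ | s := s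
      · exact absurd letter_zero hsa
      · have h1 : letter s = .a := by
          by_contra hne
          exact hsa (letter_succ_of_ne_a hne)
        have h2 : letter (s + p) = .a := by
          by_contra hne
          have := letter_succ_of_ne_a hne
          rw [show s + p + 1 = s + 1 + p by omega, ← h (s + 1) le_rfl hlt] at this
          exact hsa this
        refine ⟨s, by omega, h1, fun j hj hje => ?_⟩
        obtain rfl | hj := hj.eq_or_lt
        · rw [h1, h2]
        · exact h j hj hje
  obtain ⟨i, rfl⟩ := letter_eq_a_iff.1 hs'a
  obtain ⟨i', hi'⟩ := letter_eq_a_iff.1 ((h' _ le_rfl (by omega)).symm.trans hs'a)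
  have hii' : i < i' := pos_strictMono.lt_iff_lt.1 (by omega)
  obtain ⟨q, rfl⟩ := Nat.exists_eq_add_of_lt hii'
  rw [add_assoc] at hi'
  generalize hq : q + 1 = r at hi'
  have hpos : ∀ d, pos (i + d) < e → pos (i + d) + p = pos (i + d + r) := by
    intro d
    induction d with
    | zero => exact fun _ => hi'
    | succ d ihd =>
      intro hd
      have hlt := pos_strictMono (Nat.lt_succ_self (i + d))
      have hmono := pos_strictMono.monotone (Nat.le_add_right i d)
      have h1 := ihd (hlt.trans hd)
      have h2 := h' (pos (i + d) + 1) (by omega) (lt_of_le_of_lt hlt hd)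
      rw [add_right_comm, h1, letter_pos_add_one, letter_pos_add_one] at h2
      have h3 := next_injective h2
      rw [← add_assoc, pos, h3, show i + d + 1 + r = i + d + r + 1 by omega, pos, ← h1]
      omega
  have hletter : ∀ l, i ≤ l → pos l + 1 < e → letter l = letter (l + r) := by
    intro l hl hle
    obtain ⟨d, rfl⟩ := Nat.exists_eq_add_of_le hl
    have hmono := pos_strictMono.monotone hl
    have h2 := h' (pos (i + d) + 1) (by omega) hle
    rw [add_right_comm, hpos d (by omega), letter_pos_add_one, letter_pos_add_one] at h2
    exact next_injective h2
  obtain ⟨e', hie', he', hee', hl⟩ : ∃ e', i ≤ e' ∧ e' < e ∧ e ≤ pos e' + 1 ∧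
      ∀ l < e', pos l + 1 < e := by
    obtain ⟨l, hl | ⟨hl, hlc⟩⟩ := exists_pos (e - 1)
    · have := pos_strictMono.le_apply (x := l)
      refine ⟨l, pos_strictMono.le_iff_le.1 (by omega), by omega, by omega, fun m hm => ?_⟩
      have := pos_strictMono hm
      omega
    · have := pos_strictMono.le_apply (x := l)
      have h1 := pos_succ_of_ne hlc
      refine ⟨l + 1, (pos_strictMono.lt_iff_lt.1 (by omega)).le, by omega, by omega,
        fun m hm => ?_⟩
      have := pos_strictMono.monotone (Nat.lt_succ_iff.1 hm)
      omega
  obtain ⟨k, i₀, q₀, hq₀, h1, h2, h3⟩ := ih e' he' (p := r) (s := i) (by omega) hie'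
    (fun j hj hje => hletter j hj (hl j hje))
  obtain ⟨d, rfl⟩ := Nat.exists_eq_add_of_le h1
  refine ⟨k + 1, i₀, q₀, hq₀, ?_, ?_, ?_⟩
  · rw [iterate_succ_apply']
    exact (pos_strictMono.monotone h1).trans hs'
  · have h4 := pos_strictMono.monotone h2
    rw [pos_iterate_add k i₀ le_rfl] at h4
    rw [bisp]
    omega
  · have hd : d ≤ bisp k := by omega
    rw [add_right_comm, h3, pos_iterate_add k _ hd, pos_iterate_add k _ hd] at hi'
    omega

theorem tribAux_add_three (n : ℕ) :
    tribAux (n + 3) = tribAux (n + 2) + tribAux (n + 1) + tribAux n := rfl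

theorem tribAux_pos (n : ℕ) : 0 < tribAux (n + 1) := by
  induction n using Nat.strong_induction_on with
  | _ n ih =>
    match n with
    | 0 => simp [tribAux]
    | 1 => simp [tribAux]
    | n + 2 =>
      have : 0 < tribAux (n + 2) := ih (n + 1) (by omega)
      rw [tribAux_add_three]
      omega

theorem tribAux_strictMono : StrictMono fun n => tribAux (n + 2) := by
  apply strictMono_nat_of_lt_succ
  intro n
  have := tribAux_pos n
  have := tribAux_pos (n + 1)
  simp only [add_right_comm _ 1 2, tribAux_add_three]
  omega

theorem tribAux_mono : Monotone tribAux := by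
  apply monotone_nat_of_le_succ
  intro n
  match n with
  | 0 => simp [tribAux]
  | 1 => simp [tribAux]
  | n + 2 => exact (tribAux_strictMono (Nat.lt_succ_self n)).le

theorem two_mul_bisp_add_three (k : ℕ) :
    2 * bisp k + 3 = tribAux (k + 2) + 2 * tribAux (k + 1) + tribAux k := by
  have := two_mul_bisp_add k
  rw [tribAux_add_three] at this
  omega

theorem le_len (k : ℕ) (x : TLetter) : tribAux (k + 1) ≤ len k x := by
  have := tribAux_mono (show k + 1 ≤ k + 2 by omega)
  cases x <;> simp only [len] <;> omega

theorem iterate_pos_strictMono (k : ℕ) : StrictMono pos^[k] := pos_strictMono.iterate k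

/-- Two occurrences of a word of length `l` at distance less than `tribAux (m + 2)` force
`l ≤ bisp m`. -/
theorem le_bisp_of_shift {m s s' l : ℕ} (hs : s < s') (hd : s' < s + tribAux (m + 2))
    (h : ∀ j < l, letter (s + j) = letter (s' + j)) : l ≤ bisp m := by
  obtain ⟨k, i, q, hq, h1, h2, h3⟩ := exists_level_of_shift (p := s' - s) (s := s) (e := s + l)
    (by omega) (by omega) (by
      intro j hj hjl
      obtain ⟨j, rfl⟩ := Nat.exists_eq_add_of_le hj
      rw [h j (by omega)]
      congr 1
      omega)
  have h4 := (iterate_pos_strictMono k).monotone (Nat.add_le_add_left hq i)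
  have h5 := iterate_pos_succ k i
  have h6 := le_len k (letter i)
  have hk : k ≤ m := by
    by_contra! hk
    have := tribAux_mono (show m + 2 ≤ k + 1 by omega)
    omega
  have := bisp_mono hk
  omega

/-- There is a square of period `p` starting at position `s`. -/
def IsSquareAt (s p : ℕ) : Prop := ∀ j < p, letter (s + j) = letter (s + j + p)

theorem isSquareAt_iterate_add {k i j : ℕ} (hj : j + len k (letter i) ≤ bisp k) :
    IsSquareAt (pos^[k] i + j) (len k (letter i)) := by
  intro l hl
  rw [show pos^[k] i + j + l + len k (letter i) = pos^[k] (i + 1) + (j + l) by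
      rw [iterate_pos_succ]
      omega, add_assoc, letter_iterate_add k i (by omega), letter_iterate_add k _ (by omega)]

theorem IsSquareAt.exists_level {s p : ℕ} (hp : 1 ≤ p) (h : IsSquareAt s p) :
    ∃ k i j, s = pos^[k] i + j ∧ p = len k (letter i) ∧ j + p ≤ bisp k := by
  obtain ⟨k, i, q, hq, h1, h2, h3⟩ := exists_level_of_shift (p := p) (s := s) (e := s + p)
    hp (by omega) (by
      intro j hj hjl
      obtain ⟨j, rfl⟩ := Nat.exists_eq_add_of_le hj
      exact h j (by omega))
  obtain ⟨j, rfl⟩ := Nat.exists_eq_add_of_le h1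
  refine ⟨k, i, j, rfl, ?_, by omega⟩
  obtain rfl | hq := hq.eq_or_lt
  · rw [iterate_pos_succ] at h3
    omega
  · exfalso
    have h4 := (iterate_pos_strictMono k).monotone (Nat.add_le_add_left hq i)
    rw [show i + Nat.succ 1 = i + 1 + 1 from rfl, iterate_pos_succ, iterate_pos_succ] at h4
    have h5 := two_mul_bisp_add_three k
    have h6 := tribAux_mono (show k + 1 ≤ k + 2 by omega)
    have h7 := tribAux_mono (show k ≤ k + 1 by omega)
    have h8 : tribAux (k + 2) + tribAux (k + 1) ≤ len k (letter i) + len k (letter (i + 1)) := by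
      by_cases ha : letter i = .a
      · have := le_len k (letter (i + 1))
        rw [ha]
        simp only [len] at this ⊢
        omega
      · have := le_len k (letter i)
        rw [letter_succ_of_ne_a ha]
        simp only [len] at this ⊢
        omega
    omega

theorem IsSquareAt.congr {s s' p : ℕ} (h : IsSquareAt s p)
    (hs : ∀ j < 2 * p, letter (s' + j) = letter (s + j)) : IsSquareAt s' p := by
  intro j hj
  rw [hs j (by omega), h j hj, add_assoc, add_assoc, hs (j + p) (by omega)]

/-- There is a square of period `p` starting at `s` which does not occur earlier. -/
def IsNew (s p : ℕ) : Prop :=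
  1 ≤ p ∧ IsSquareAt s p ∧ ∀ s' < s, ¬ ∀ j < 2 * p, letter (s' + j) = letter (s + j)

theorem two_le_of_len_b_le {k : ℕ} (h : len k .b ≤ bisp k) : 2 ≤ k := by
  match k with
  | 0 => simp [len, bisp, tribAux] at h
  | 1 => simp [len, bisp, tribAux, pos] at h
  | k + 2 => omega

theorem len_b_ne_tribAux {k : ℕ} (h : len k .b ≤ bisp k) (m : ℕ) :
    len k .b ≠ tribAux (m + 2) := by
  obtain ⟨k, rfl⟩ := Nat.exists_eq_add_of_le' (two_le_of_len_b_le h)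
  have h1 : 0 < tribAux (k + 1) := tribAux_pos k
  have h2 : 0 < tribAux (k + 2) := tribAux_pos (k + 1)
  have h3 := tribAux_add_three (k + 1)
  simp only [add_assoc, Nat.reduceAdd, len] at h3 ⊢
  rcases le_or_gt (m + 2) (k + 3) with hm | hm
  · have := tribAux_mono hm
    omega
  · have := tribAux_mono (show k + 4 ≤ m + 2 by omega)
    omega

theorem len_b_injOn {k k' : ℕ} (hk : 2 ≤ k) (hk' : 2 ≤ k') (h : len k .b = len k' .b) :
    k = k' := by
  wlog hlt : k < k' generalizing k k'
  · by_contra hne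
    exact hne (this hk' hk h.symm (by omega)).symm
  · obtain ⟨k, rfl⟩ := Nat.exists_eq_add_of_le' hk
    have h1 : tribAux (k + 2) < tribAux (k + 3) := tribAux_strictMono (Nat.lt_succ_self k)
    have h2 := tribAux_mono (show k + 3 ≤ k' by omega)
    have h3 := tribAux_mono (show k + 3 ≤ k' + 1 by omega)
    simp only [len, add_assoc, Nat.reduceAdd] at h
    omega

theorem isNew_a {k s : ℕ} (h : s + tribAux (k + 2) ≤ bisp k) : IsNew s (tribAux (k + 2)) := by
  refine ⟨tribAux_pos _, ?_, fun s' hs' hw => ?_⟩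
  · have := isSquareAt_iterate_add (k := k) (i := 0) (j := s)
    rw [iterate_pos_zero, zero_add, letter_zero] at this
    exact this h
  · have h1 := two_mul_bisp_add_three k
    have h2 := tribAux_mono (show k + 1 ≤ k + 2 by omega)
    have h3 := tribAux_mono (show k ≤ k + 1 by omega)
    have := le_bisp_of_shift (m := k) hs' (by omega) hw
    omega

theorem isNew_b {k j : ℕ} (h : j + len k .b ≤ bisp k) :
    IsNew (tribAux (k + 2) + j) (len k .b) := by
  have hlb := le_len k .b
  have hk := two_le_of_len_b_le (le_trans (Nat.le_add_left _ _) h)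
  have hpos := tribAux_pos k
  refine ⟨by omega, ?_, fun s' hs' hw => ?_⟩
  · have := isSquareAt_iterate_add (k := k) (i := 1) (j := j)
    rw [iterate_pos_one, letter_one] at this
    exact this h
  · have hsq : IsSquareAt (tribAux (k + 2) + j) (len k .b) := by
      have := isSquareAt_iterate_add (k := k) (i := 1) (j := j)
      rw [iterate_pos_one, letter_one] at this
      exact this h
    obtain ⟨k', i', j', rfl, hlen, hj'⟩ := (hsq.congr hw).exists_level (by omega)
    have hne := len_b_ne_tribAux (le_trans (Nat.le_add_left _ _) h)
    have hb : letter i' = .b := by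
      rcases hx : letter i' with _ | _ | _
      · rw [hx] at hlen
        exact absurd hlen (hne k')
      · rfl
      · rw [hx] at hlen
        obtain _ | k' := k'
        · have : bisp 0 = 0 := rfl
          omega
        · exact absurd hlen (hne k')
    rw [hb] at hlen
    have hkk : k = k' := len_b_injOn hk
      (two_le_of_len_b_le (hlen ▸ le_trans (Nat.le_add_left _ _) hj')) hlen
    subst hkk
    have hi' : 1 ≤ i' := by
      by_contra! h0
      rw [Nat.lt_one_iff.1 h0, letter_zero] at hb
      contradiction
    have hle := (iterate_pos_strictMono k).monotone hi'
    rw [iterate_pos_one] at hle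
    have h1 := two_mul_bisp_add_three k
    have h2 := tribAux_mono (show k ≤ k + 1 by omega)
    have h3 := tribAux_mono (show k + 1 ≤ k + 2 by omega)
    have hlb' : len k .b = tribAux (k + 1) + tribAux k := rfl
    obtain ⟨l, rfl⟩ := Nat.exists_eq_add_of_le' hk
    have h4 := tribAux_add_three l
    have h5 : tribAux (l + 2 + 1) = tribAux (l + 3) := rfl
    have h8 : tribAux (l + 2 + 2) = tribAux (l + 3) + tribAux (l + 2) + tribAux (l + 1) := rfl
    have h6 := tribAux_mono (show l + 1 ≤ l + 2 by omega)
    have h7 := tribAux_mono (show l ≤ l + 1 by omega)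
    have := le_bisp_of_shift (m := l + 2) (s := tribAux (l + 2 + 2) + j')
      (s' := tribAux (l + 2 + 2) + j) (l := 2 * len (l + 2) .b) (by omega) (by omega) (by
        intro m hm
        rw [← hw m hm, ← iterate_pos_one, add_assoc, add_assoc]
        apply letter_iterate_add_congr
        · rw [hb, letter_one]
        · rw [letter_one]
          omega)
    omega

theorem letter_pos_three : letter (pos 3) = letter 0 := letter_pos 3

theorem isNew_c {k j : ℕ} (hj : j < tribAux (k + 2)) (h : j ≤ bisp k)
    (hnew : bisp k < j + tribAux (k + 2)) :
    IsNew (pos^[k + 1] 3 + j) (tribAux (k + 2)) := by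
  have hsq : IsSquareAt (pos^[k + 1] 3 + j) (tribAux (k + 2)) := by
    have hb := bisp_succ k
    have := isSquareAt_iterate_add (k := k + 1) (i := 3) (j := j)
    rw [letter_three] at this
    exact this (by simp only [len, add_assoc, Nat.reduceAdd]; omega)
  refine ⟨tribAux_pos _, hsq, fun s' hs' hw => ?_⟩
  suffices ∃ j' < j, ∀ l < 2 * tribAux (k + 2),
      letter (pos^[k + 1] 3 + j' + l) = letter (pos^[k + 1] 3 + j + l) by
    obtain ⟨j', hj', hl⟩ := this
    have h1 := two_mul_bisp_add_three k
    have h2 := tribAux_mono (show k + 1 ≤ k + 2 by omega)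
    have h3 := tribAux_mono (show k ≤ k + 1 by omega)
    have := le_bisp_of_shift (m := k) (by omega) (by omega) hl
    omega
  obtain ⟨k', i', j', rfl, hlen, hj'⟩ := (hsq.congr hw).exists_level (tribAux_pos _)
  have hinj {m : ℕ} (hm : tribAux (k + 2) = tribAux (m + 2)) : m = k :=
    (tribAux_strictMono.injective hm).symm
  rcases hx : letter i' with _ | _ | _
  · rw [hx] at hlen
    obtain rfl := hinj hlen
    have hlen' : len k' .a = tribAux (k' + 2) := rfl
    refine ⟨j', by omega, fun l hl => ?_⟩
    rw [← hw l hl, add_assoc, add_assoc, iterate_succ_apply]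
    apply letter_iterate_add_congr
    · rw [letter_pos_three, letter_zero, hx]
    · rw [letter_pos_three, letter_zero]
      omega
  · rw [hx] at hlen
    exact absurd hlen.symm (len_b_ne_tribAux (by omega) k)
  · rw [hx] at hlen
    obtain _ | k' := k'
    · have : bisp 0 = 0 := rfl
      have := tribAux_pos (k + 1)
      omega
    obtain rfl := hinj hlen
    have hi' : 3 ≤ i' := by
      by_contra! h0
      interval_cases i' <;> cases hx
    have hle := (iterate_pos_strictMono (k' + 1)).monotone hi'
    have hlen' : len (k' + 1) .c = tribAux (k' + 2) := rfl
    refine ⟨j', by omega, fun l hl => ?_⟩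
    rw [← hw l hl, add_assoc, add_assoc]
    apply letter_iterate_add_congr
    · rw [letter_three, hx]
    · rw [letter_three, ← hlen]
      omega

/-- The three families of first occurrences of squares. -/
theorem isNew_iff {s p : ℕ} : IsNew s p ↔ ∃ k,
    (p = tribAux (k + 2) ∧ s + p ≤ bisp k) ∨
    (p = tribAux (k + 1) + tribAux k ∧ ∃ j, s = tribAux (k + 2) + j ∧ j + p ≤ bisp k) ∨
    (p = tribAux (k + 2) ∧ ∃ j, s = pos^[k + 1] 3 + j ∧ j < p ∧ j ≤ bisp k ∧ bisp k < j + p) := by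
  constructor
  · rintro ⟨hp, hsq, hnew⟩
    obtain ⟨k, i, j, rfl, hlen, hj⟩ := hsq.exists_level hp
    have hmin {i₀ : ℕ} (h0 : i₀ < i) (heq : letter i₀ = letter i) : False := by
      have hlt := iterate_pos_strictMono k h0
      refine hnew (pos^[k] i₀ + j) (by omega) fun l hl => ?_
      rw [add_assoc, add_assoc]
      apply letter_iterate_add_congr k heq
      rw [heq, ← hlen]
      omega
    rcases hx : letter i with _ | _ | _
    · rw [hx] at hlen hmin
      obtain rfl : i = 0 := by
        by_contra h0
        exact hmin (Nat.pos_of_ne_zero h0) letter_zero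
      refine ⟨k, Or.inl ⟨hlen, ?_⟩⟩
      rwa [iterate_pos_zero, zero_add]
    · rw [hx] at hlen hmin
      obtain rfl : i = 1 := by
        by_contra h1
        have h0 : i ≠ 0 := by
          rintro rfl
          cases hx
        exact hmin (by omega : 1 < i) letter_one
      exact ⟨k, Or.inr (Or.inl ⟨hlen, j, by rw [iterate_pos_one], hj⟩)⟩
    · rw [hx] at hlen hmin
      obtain rfl : i = 3 := by
        by_contra h1
        have h0 : 3 ≤ i := by
          by_contra! h0
          interval_cases i <;> cases hx
        exact hmin (by omega : 3 < i) letter_three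
      obtain _ | k := k
      · have : bisp 0 = 0 := rfl
        omega
      have hlen' : p = tribAux (k + 2) := hlen
      have hb := bisp_succ k
      refine ⟨k, Or.inr (Or.inr ⟨hlen, j, rfl, ?_, by omega, ?_⟩)⟩
      · by_contra! hpj
        obtain ⟨j, rfl⟩ := Nat.exists_eq_add_of_le hpj
        refine hnew (pos^[k + 1] 3 + j) (by omega) fun l hl => ?_
        have h4 := iterate_pos_succ (k + 1) 3
        rw [letter_three, ← hlen] at h4
        rw [show pos^[k + 1] 3 + (p + j) + l = pos^[k + 1] (3 + 1) + (j + l) by omega,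
          add_assoc, letter_iterate_add _ _ (by omega), letter_iterate_add _ _ (by omega)]
      · by_contra! hpj
        have h3 : 0 < pos^[k + 1] 3 := by
          rw [iterate_pos_three]
          have : 0 < tribAux (k + 1 + 2) := tribAux_pos (k + 2)
          omega
        refine hnew j (by omega) fun l hl => ?_
        have := letter_iterate_add_congr k (i := pos 3) (i' := 0) (j := j + l) letter_pos_three
          (by
            rw [letter_pos_three, letter_zero]
            simp only [len]
            omega)
        rw [iterate_succ_apply, add_assoc, this, iterate_pos_zero, zero_add]
  · rintro ⟨k, ⟨rfl, h⟩ | ⟨rfl, j, rfl, h⟩ | ⟨rfl, j, rfl, h1, h2, h3⟩⟩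
    · exact isNew_a h
    · exact isNew_b h
    · exact isNew_c h1 h2 h3

/-! ### Counting distinct squares -/

/-- The factor of the Tribonacci word of length `l` starting at position `s`. -/
def word (s l : ℕ) : List TLetter := (List.range l).map fun j => letter (s + j)

@[simp] theorem length_word (s l : ℕ) : (word s l).length = l := by simp [word]

theorem word_add (s l l' : ℕ) : word s (l + l') = word s l ++ word (s + l) l' := by
  simp [word, List.range_add, add_assoc]

theorem word_eq_word_iff {s s' l : ℕ} :
    word s l = word s' l ↔ ∀ j < l, letter (s + j) = letter (s' + j) := by
  simp [word, List.map_inj_left]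

theorem TPrefix_eq_word (n : ℕ) : TPrefix n = word 0 n := by
  simp [TPrefix_eq_map, word]

theorem infix_TPrefix_iff {w : List TLetter} {n : ℕ} :
    w <:+: TPrefix n ↔ ∃ s, s + w.length ≤ n ∧ w = word s w.length := by
  rw [TPrefix_eq_word]
  constructor
  · rintro ⟨u, v, h⟩
    have hn := congrArg List.length h
    simp only [List.length_append, length_word] at hn
    refine ⟨u.length, by omega, ?_⟩
    rw [← hn, word_add, word_add, zero_add] at h
    exact (List.append_inj (List.append_inj h (by simp)).1 (by simp)).2
  · rintro ⟨s, hs, hw⟩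
    obtain ⟨r, rfl⟩ := Nat.exists_eq_add_of_le hs
    rw [word_add, word_add, zero_add, ← hw]
    exact ⟨_, _, rfl⟩

/-- The set of the words whose squares occur in the prefix of length `n`. -/
def squares (n : ℕ) : Set (List TLetter) := {w | w ≠ [] ∧ (w ++ w) <:+: TPrefix n}

theorem mem_squares_iff {w : List TLetter} {n : ℕ} :
    w ∈ squares n ↔ ∃ s p, 1 ≤ p ∧ s + 2 * p ≤ n ∧ IsSquareAt s p ∧ w = word s p := by
  have hsq (s p : ℕ) : IsSquareAt s p ↔ word s p = word (s + p) p := by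
    rw [word_eq_word_iff]
    simp only [IsSquareAt, add_right_comm s p]
  simp only [squares, Set.mem_ofPred_eq, infix_TPrefix_iff, List.length_append]
  constructor
  · rintro ⟨hw, s, hs, h⟩
    rw [word_add] at h
    obtain ⟨h1, h2⟩ := List.append_inj h (by simp)
    exact ⟨s, w.length, List.length_pos_iff.2 hw, by omega, (hsq _ _).2 (h1.symm.trans h2), h1⟩
  · rintro ⟨s, p, hp, hs, h, rfl⟩
    refine ⟨?_, s, ?_, ?_⟩
    · rw [← List.length_pos_iff, length_word]
      omega
    · rw [length_word]
      omega
    · rw [length_word, word_add, ← (hsq _ _).1 h]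

theorem squares_finite (n : ℕ) : (squares n).Finite := by
  apply ((Set.finite_Iic n).image2 word (Set.finite_Iic n)).subset
  intro w hw
  obtain ⟨s, p, -, hs, -, rfl⟩ := mem_squares_iff.1 hw
  exact Set.mem_image2_of_mem (Set.mem_Iic.2 (by omega)) (Set.mem_Iic.2 (by omega))

theorem A_eq_ncard (n : ℕ) : A n = (squares n).ncard := rfl

theorem squares_subset_succ (n : ℕ) : squares n ⊆ squares (n + 1) := by
  intro w hw
  obtain ⟨s, p, hp, hs, h⟩ := mem_squares_iff.1 hw
  exact mem_squares_iff.2 ⟨s, p, hp, by omega, h⟩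

theorem exists_isNew_of_mem_succ {w : List TLetter} {n : ℕ} (hw : w ∈ squares (n + 1))
    (hn : w ∉ squares n) : ∃ s p, IsNew s p ∧ s + 2 * p = n + 1 ∧ w = word s p := by
  obtain ⟨s, p, hp, hs, h, rfl⟩ := mem_squares_iff.1 hw
  have hs' : s + 2 * p = n + 1 := by
    by_contra hne
    exact hn (mem_squares_iff.2 ⟨s, p, hp, by omega, h, rfl⟩)
  refine ⟨s, p, ⟨hp, h, fun s' hlt hw' => hn ?_⟩, hs', rfl⟩
  exact mem_squares_iff.2 ⟨s', p, hp, by omega, h.congr hw',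
    (word_eq_word_iff.2 fun j hj => hw' j (by omega)).symm⟩

theorem IsNew.word_notMem_squares {s p n : ℕ} (h : IsNew s p) (hn : s + 2 * p = n + 1) :
    word s p ∉ squares n := by
  intro hw
  obtain ⟨s', p', hp, hs, hsq, heq⟩ := mem_squares_iff.1 hw
  have hpp : p = p' := by simpa using congrArg List.length heq
  subst hpp
  rw [word_eq_word_iff] at heq
  refine h.2.2 s' (by omega) fun j hj => ?_
  rcases lt_or_ge j p with hjp | hjp
  · exact (heq j hjp).symm
  · obtain ⟨l, rfl⟩ := Nat.exists_eq_add_of_le' hjp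
    rw [← add_assoc, ← add_assoc, ← hsq l (by omega), ← h.2.1 l (by omega)]
    exact (heq l (by omega)).symm

theorem A_succ_of_forall_not_isNew {n : ℕ} (h : ∀ s p, IsNew s p → s + 2 * p ≠ n + 1) :
    A (n + 1) = A n := by
  rw [A_eq_ncard, A_eq_ncard]
  congr 1
  refine Set.Subset.antisymm (fun w hw => ?_) (squares_subset_succ n)
  by_contra hn
  obtain ⟨s, p, hnew, hs, -⟩ := exists_isNew_of_mem_succ hw hn
  exact h s p hnew hs

theorem A_succ_of_isNew {n s p : ℕ} (h : IsNew s p) (hn : s + 2 * p = n + 1)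
    (huniq : ∀ s' p', IsNew s' p' → s' + 2 * p' = n + 1 → p' = p) : A (n + 1) = A n + 1 := by
  rw [A_eq_ncard, A_eq_ncard, ← Set.ncard_insert_of_notMem (h.word_notMem_squares hn)
    (squares_finite n)]
  congr 1
  ext w
  rw [Set.mem_insert_iff]
  constructor
  · intro hw
    by_contra! hne
    obtain ⟨s', p', hnew, hs, rfl⟩ := exists_isNew_of_mem_succ hw hne.2
    obtain rfl := huniq s' p' hnew hs
    obtain rfl : s' = s := by omega
    exact hne.1 rfl
  · rintro (rfl | hw)
    · exact mem_squares_iff.2 ⟨s, p, h.1, hn.le, h.2.1, rfl⟩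
    · exact squares_subset_succ n hw

/-! ### The increments -/

theorem level_unique {k l n : ℕ} (hk : 2 * tribAux (k + 2) ≤ n) (hk' : n < 2 * tribAux (k + 3))
    (hl : 2 * tribAux (l + 2) ≤ n) (hl' : n < 2 * tribAux (l + 3)) : k = l := by
  rcases lt_trichotomy k l with h | h | h
  · have := tribAux_mono (show k + 3 ≤ l + 2 by omega)
    omega
  · exact h
  · have := tribAux_mono (show l + 3 ≤ k + 2 by omega)
    omega

theorem tribAux_le_bisp_add_one (k : ℕ) : tribAux (k + 2) ≤ bisp k + 1 := by
  obtain _ | _ | k := k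
  · simp [tribAux]
  · simp [tribAux, bisp_succ]
  · have h1 := two_mul_bisp_add (k + 2)
    have h2 := tribAux_add_three (k + 2)
    have h3 := tribAux_add_three (k + 1)
    have h4 := tribAux_add_three k
    have h5 := tribAux_pos k
    simp only [add_assoc, Nat.reduceAdd] at h1 h2 h3 h4 ⊢
    omega

theorem IsNew.cases {k s p : ℕ} (h : IsNew s p) (h1 : 2 * tribAux (k + 4) ≤ s + 2 * p)
    (h2 : s + 2 * p < 2 * tribAux (k + 5)) :
    (p = tribAux (k + 4) ∧ s + p ≤ bisp (k + 2)) ∨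
    (p = tribAux (k + 3) + tribAux (k + 2) ∧ tribAux (k + 4) ≤ s ∧
      s + p ≤ tribAux (k + 4) + bisp (k + 2)) ∨
    (p = tribAux (k + 2) ∧ tribAux (k + 5) + bisp k < s + 2 * p ∧
      s + 2 * p < tribAux (k + 5) + 2 * tribAux (k + 2)) := by
  obtain ⟨l, ⟨rfl, h⟩ | ⟨rfl, j, rfl, h⟩ | ⟨rfl, j, rfl, h3, h4, h5⟩⟩ := isNew_iff.1 h
  · have e1 := tribAux_add_three l
    have e2 := two_mul_bisp_add_three l
    obtain rfl := level_unique (k := k + 2) (l := l) h1 h2 (by omega) (by omega)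
    exact Or.inl ⟨rfl, h⟩
  · have e1 := tribAux_add_three l
    have e2 := two_mul_bisp_add_three l
    have e3 : tribAux (l + 2) ≤ 2 * tribAux (l + 1) + 2 * tribAux l := by
      obtain _ | l := l
      · simp [tribAux]
      · have := tribAux_mono (show l ≤ l + 1 by omega)
        have := tribAux_add_three l
        simp only [add_assoc, Nat.reduceAdd]
        omega
    have e4 := tribAux_pos (l + 2)
    obtain rfl := level_unique (k := k + 2) (l := l) h1 h2 (by omega) (by omega)
    have e5 : tribAux (k + 2 + 2) = tribAux (k + 4) := rfl
    exact Or.inr (Or.inl ⟨rfl, by omega, by omega⟩)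
  · have e0 := iterate_pos_three (l + 1)
    have e1 := tribAux_add_three (l + 1)
    have e2 := tribAux_add_three (l + 2)
    have e3 := tribAux_mono (show l + 1 ≤ l + 2 by omega)
    have e4 := tribAux_mono (show l + 2 ≤ l + 3 by omega)
    have e5 := tribAux_mono (show l + 3 ≤ l + 4 by omega)
    simp only [add_assoc, Nat.reduceAdd] at e0 e1 e2
    have := level_unique (k := k + 2) (l := l + 2) h1 h2
      (by simp only [add_assoc, Nat.reduceAdd]; omega)
      (by simp only [add_assoc, Nat.reduceAdd]; omega)
    obtain rfl : k = l := by omega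
    exact Or.inr (Or.inr ⟨rfl, by omega, by omega⟩)

theorem IsNew.period_unique {k s p s' p' : ℕ} (h : IsNew s p) (h' : IsNew s' p')
    (heq : s' + 2 * p' = s + 2 * p) (h1 : 2 * tribAux (k + 4) ≤ s + 2 * p)
    (h2 : s + 2 * p < 2 * tribAux (k + 5)) : p' = p := by
  have c := h.cases h1 h2
  have c' := h'.cases (heq ▸ h1) (heq ▸ h2)
  have e1 := bisp_succ k
  have e2 := bisp_succ (k + 1)
  have e3 := tribAux_add_three (k + 2)
  have e4 := tribAux_mono (show k + 2 ≤ k + 3 by omega)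
  have e5 := tribAux_add_three (k + 1)
  have e6 := two_mul_bisp_add_three k
  have e7 := tribAux_add_three k
  simp only [add_assoc, Nat.reduceAdd] at e2 e3 e5
  omega

theorem exists_isNew_iff {k n : ℕ} (h1 : 2 * tribAux (k + 4) ≤ n)
    (h2 : n < 2 * tribAux (k + 5)) :
    (∃ s p, IsNew s p ∧ s + 2 * p = n) ↔
      n < tribAux (k + 5) + 2 * tribAux (k + 2) ∨
      (2 * tribAux (k + 5) ≤ n + tribAux (k + 4) ∧
        2 * n + 3 ≤ 3 * tribAux (k + 5) + tribAux (k + 3)) := by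
  have e1 := bisp_succ k
  have e2 := bisp_succ (k + 1)
  have e3 := tribAux_add_three (k + 2)
  have e4 := tribAux_add_three (k + 1)
  have e5 := two_mul_bisp_add (k + 2)
  have e6 := tribAux_le_bisp_add_one k
  have e7 := iterate_pos_three (k + 1)
  simp only [add_assoc, Nat.reduceAdd] at e2 e3 e4 e5 e7
  constructor
  · rintro ⟨s, p, h, rfl⟩
    have c := h.cases h1 h2
    have := two_mul_bisp_add_three k
    have := tribAux_mono (show k + 1 ≤ k + 2 by omega)
    have := tribAux_mono (show k ≤ k + 1 by omega)
    omega
  · rintro (h | ⟨h3, h4⟩)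
    · rcases le_or_gt n (tribAux (k + 4) + bisp (k + 2)) with hn | hn
      · refine ⟨n - 2 * tribAux (k + 4), _, isNew_a (k := k + 2) ?_, ?_⟩ <;>
          simp only [add_assoc, Nat.reduceAdd] <;> omega
      · refine ⟨pos^[k + 1] 3 + (n - (tribAux (k + 5) + tribAux (k + 2))), _,
          isNew_c (k := k) ?_ ?_ ?_, ?_⟩ <;> omega
    · refine ⟨tribAux (k + 2 + 2) + (n - (tribAux (k + 4) + 2 * len (k + 2) .b)), _,
          isNew_b (k := k + 2) ?_, ?_⟩ <;>
        simp only [add_assoc, Nat.reduceAdd, len] <;> omega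

theorem A_succ_of_level {k n : ℕ} (h1 : 2 * tribAux (k + 4) ≤ n + 1)
    (h2 : n + 1 < 2 * tribAux (k + 5)) :
    ((n + 1 < tribAux (k + 5) + 2 * tribAux (k + 2) ∨
      (2 * tribAux (k + 5) ≤ n + 1 + tribAux (k + 4) ∧
        2 * (n + 1) + 3 ≤ 3 * tribAux (k + 5) + tribAux (k + 3))) → A (n + 1) = A n + 1) ∧
    (¬(n + 1 < tribAux (k + 5) + 2 * tribAux (k + 2) ∨
      (2 * tribAux (k + 5) ≤ n + 1 + tribAux (k + 4) ∧
        2 * (n + 1) + 3 ≤ 3 * tribAux (k + 5) + tribAux (k + 3))) → A (n + 1) = A n) := by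
  rw [← exists_isNew_iff h1 h2]
  constructor
  · rintro ⟨s, p, h, hn⟩
    refine A_succ_of_isNew h hn fun s' p' h' hn' => ?_
    exact h.period_unique h' (hn'.trans hn.symm) (hn ▸ h1) (hn ▸ h2)
  · intro h
    exact A_succ_of_forall_not_isNew fun s p hnew hn => h ⟨s, p, hnew, hn⟩

theorem IsNew.eight_le {s p : ℕ} (h : IsNew s p) : 8 ≤ s + 2 * p := by
  obtain ⟨k, ⟨rfl, h⟩ | ⟨rfl, j, rfl, h⟩ | ⟨rfl, j, rfl, h3, h4, h5⟩⟩ := isNew_iff.1 h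
  · have hk : 3 ≤ k := by
      by_contra! hk
      have b0 : bisp 0 = 0 := rfl
      have b1 : bisp 1 = 1 := rfl
      have b2 : bisp 2 = 3 := rfl
      interval_cases k <;> simp only [tribAux] at h <;> omega
    have : 7 ≤ tribAux (k + 2) := tribAux_mono (show 5 ≤ k + 2 by omega)
    omega
  · have hk := two_le_of_len_b_le (k := k) (by simp only [len]; omega)
    have : 4 ≤ tribAux (k + 2) := tribAux_mono (show 4 ≤ k + 2 by omega)
    have : 2 ≤ tribAux (k + 1) := tribAux_mono (show 3 ≤ k + 1 by omega)
    omega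
  · have e := iterate_pos_three (k + 1)
    have : 2 ≤ tribAux (k + 1 + 2) := tribAux_mono (show 3 ≤ k + 1 + 2 by omega)
    have : 1 ≤ tribAux (k + 1 + 1) := tribAux_pos _
    have : 1 ≤ tribAux (k + 1) := tribAux_pos _
    have : 1 ≤ tribAux (k + 2) := tribAux_pos _
    omega

theorem A_zero : A 0 = 0 := by
  rw [A_eq_ncard, Set.ncard_eq_zero (squares_finite 0), Set.eq_empty_iff_forall_notMem]
  intro w hw
  obtain ⟨s, p, hp, hs, -⟩ := mem_squares_iff.1 hw
  omega

end Tribonacci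

theorem distinct_squares_increments :
    A 0 = 0 ∧
    (∀ n : ℕ, 1 ≤ n → n ≤ 13 →
      ((n = 8 ∨ n = 10) → A n = A (n - 1) + 1) ∧
      (¬(n = 8 ∨ n = 10) → A n = A (n - 1))) ∧
    (∀ n : ℕ, 14 ≤ n → ∀ m : ℤ,
      2 * (t (m - 1) : ℤ) ≤ (n : ℤ) → (n : ℤ) < 2 * (t m : ℤ) →
      4 ≤ m ∧
      (((2 * (t (m - 1) : ℚ) ≤ (n : ℚ) ∧ (n : ℚ) ≤ (t m : ℚ) + 2 * (t (m - 3) : ℚ) - 1) ∨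
        (2 * (t m : ℚ) - (t (m - 1) : ℚ) ≤ (n : ℚ) ∧
          (n : ℚ) ≤ (3 * (t m : ℚ) + (t (m - 2) : ℚ) - 3) / 2)) →
        A n = A (n - 1) + 1) ∧
      (¬((2 * (t (m - 1) : ℚ) ≤ (n : ℚ) ∧ (n : ℚ) ≤ (t m : ℚ) + 2 * (t (m - 3) : ℚ) - 1) ∨
        (2 * (t m : ℚ) - (t (m - 1) : ℚ) ≤ (n : ℚ) ∧
          (n : ℚ) ≤ (3 * (t m : ℚ) + (t (m - 2) : ℚ) - 3) / 2)) →
        A n = A (n - 1))) := by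
  refine ⟨Tribonacci.A_zero, fun n hn1 hn13 => ?_, fun n hn m hm1 hm2 => ?_⟩
  · obtain ⟨n, rfl⟩ := Nat.exists_eq_add_of_le' hn1
    rw [Nat.add_sub_cancel]
    rcases lt_or_ge n 7 with h7 | h7
    · refine ⟨fun h => by omega, fun _ => Tribonacci.A_succ_of_forall_not_isNew fun s p h hs => ?_⟩
      have := h.eight_le
      omega
    · obtain ⟨h1, h2⟩ := Tribonacci.A_succ_of_level (k := 0) (n := n)
        (by simp [tribAux]; omega) (by simp [tribAux]; omega)
      simp only [tribAux] at h1 h2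
      exact ⟨fun h => h1 (by omega), fun h => h2 (by omega)⟩
  · have hm4 : 4 ≤ m := by
      by_contra! hm
      have h : t m ≤ 7 := Tribonacci.tribAux_mono (show (m + 2).toNat ≤ 5 by omega)
      omega
    refine ⟨hm4, ?_⟩
    obtain ⟨k, rfl⟩ : ∃ k : ℕ, m = k + 3 := ⟨(m - 3).toNat, by omega⟩
    have t0 : t (k + 3 : ℤ) = tribAux (k + 5) := by
      rw [t]
      congr 1
    have t1 : t (k + 3 - 1 : ℤ) = tribAux (k + 4) := by
      rw [t]
      congr 1
      omega
    have t2 : t (k + 3 - 2 : ℤ) = tribAux (k + 3) := by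
      rw [t]
      congr 1
      omega
    have t3 : t (k + 3 - 3 : ℤ) = tribAux (k + 2) := by
      rw [t]
      congr 1
      omega
    rw [t0, t1, t2, t3]
    rw [t1] at hm1
    rw [t0] at hm2
    obtain ⟨n, rfl⟩ := Nat.exists_eq_add_of_le' (show 1 ≤ n by omega)
    rw [Nat.add_sub_cancel]
    have key := Tribonacci.A_succ_of_level (k := k) (n := n) (by omega) (by omega)
    have c1 : (2 * (tribAux (k + 4) : ℚ) ≤ ((n + 1 : ℕ) : ℚ) ∧
        ((n + 1 : ℕ) : ℚ) ≤ (tribAux (k + 5) : ℚ) + 2 * (tribAux (k + 2) : ℚ) - 1) ↔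
        n + 1 < tribAux (k + 5) + 2 * tribAux (k + 2) := by
      rw [le_sub_iff_add_le]
      norm_cast
      omega
    have c2 : (2 * (tribAux (k + 5) : ℚ) - (tribAux (k + 4) : ℚ) ≤ ((n + 1 : ℕ) : ℚ) ∧
        ((n + 1 : ℕ) : ℚ) ≤ (3 * (tribAux (k + 5) : ℚ) + (tribAux (k + 3) : ℚ) - 3) / 2) ↔
        2 * tribAux (k + 5) ≤ n + 1 + tribAux (k + 4) ∧
          2 * (n + 1) + 3 ≤ 3 * tribAux (k + 5) + tribAux (k + 3) := by
      rw [sub_le_iff_le_add, le_div_iff₀ two_pos, le_sub_iff_add_le]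
      norm_cast
      omega
    rwa [c1, c2]
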